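/- Let n ≤ N be positive integers, A ∈ ℝ and H ∈ ℝ, and let T = 1{ X_{[N]×[N]} > H } where X_{[N]×[N]} = Σ_{1≤i,j≤N} X_{ij}. Then E₀( L_π² · 1{T = 0} ) = Φ( (H − 2A·n²)/N ) · Σ_{0≤k,ℓ≤n} (N_{k,ℓ}/|S|) · exp(A²·k·ℓ), where N_{k,ℓ} = C(n,k)·C(N−n, n−k)·C(n,ℓ)·C(N−n, n−ℓ). -/

import Mathlib

open MeasureTheory ProbabilityTheory Real Filter Topology

noncomputable section

/-- Law of the N×N Gaussian observation matrix with mean matrix θ and unit variances. -/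
def PTheta (N : ℕ) (θ : Fin N → Fin N → ℝ) : Measure (Fin N → Fin N → ℝ) :=
  Measure.pi fun i => Measure.pi fun j => gaussianReal (θ i j) 1

/-- Parameter space Θ(A, n, N). -/
def ThetaSet (A : ℝ) (n N : ℕ) : Set (Fin N → Fin N → ℝ) :=
  {θ | ∃ R C : Finset (Fin N), R.card = n ∧ C.card = n ∧
    (∀ i j, i ∈ R → j ∈ C → A ≤ θ i j) ∧
    (∀ i j, ¬(i ∈ R ∧ j ∈ C) → θ i j = 0)}

/-- Risk of the test with rejection region `T`: type-I error plus worst-case type-II error. -/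
def testRisk (n N : ℕ) (A : ℝ) (T : Set (Fin N → Fin N → ℝ)) : ℝ :=
  (PTheta N 0 T).toReal + ⨆ θ : ThetaSet A n N, (PTheta N θ.1 Tᶜ).toReal

/-- Minimax risk over all (measurable) tests. -/
def minimaxRisk (n N : ℕ) (A : ℝ) : ℝ :=
  ⨅ T : {T : Set (Fin N → Fin N → ℝ) // MeasurableSet T}, testRisk n N A T.1

/-- The family S of n×n product subsets R×C of [N]×[N]. -/
def SIdx (n N : ℕ) : Type :=
  {p : Finset (Fin N) × Finset (Fin N) // p.1.card = n ∧ p.2.card = n}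

instance (n N : ℕ) : Fintype (SIdx n N) := by unfold SIdx; infer_instance

/-- The sum X_S of the entries of x over the product set S = R×C. -/
def XS {n N : ℕ} (S : SIdx n N) (x : Fin N → Fin N → ℝ) : ℝ :=
  ∑ i ∈ S.1.1, ∑ j ∈ S.1.2, x i j

/-- The standard normal CDF Φ. -/
def stdGaussianCDF (x : ℝ) : ℝ := ((gaussianReal 0 1) (Set.Iic x)).toReal

/-- The integrated likelihood ratio `L_π = (1/|S|) Σ_S exp(A X_S − A²n²/2)`. -/
def Lpi (n N : ℕ) (A : ℝ) (x : Fin N → Fin N → ℝ) : ℝ :=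
  (((N.choose n : ℝ)) ^ 2)⁻¹ * ∑ S : SIdx n N, Real.exp (A * XS S x - A ^ 2 * (n : ℝ) ^ 2 / 2)

lemma integrable_exp_lin (N : ℕ) (a : Fin N → Fin N → ℝ) :
    Integrable (fun x : Fin N → Fin N → ℝ => Real.exp (∑ i, ∑ j, a i j * x i j)) (PTheta N 0) := by
  unfold PTheta
  simp_rw [Real.exp_sum]
  refine Integrable.fintype_prod_dep (f := fun i (y : Fin N → ℝ) => ∏ j, Real.exp (a i j * y j)) ?_
  intro i
  refine Integrable.fintype_prod_dep (f := fun j (y : ℝ) => Real.exp (a i j * y)) ?_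
  intro j
  exact integrable_exp_mul_gaussianReal _

lemma integral_exp_lin (N : ℕ) (a : Fin N → Fin N → ℝ) :
    ∫ x : Fin N → Fin N → ℝ, Real.exp (∑ i, ∑ j, a i j * x i j) ∂(PTheta N 0)
      = Real.exp (∑ i, ∑ j, a i j ^ 2 / 2) := by
  unfold PTheta
  simp_rw [Real.exp_sum]
  rw [integral_fintype_prod_eq_prod (f := fun i (y : Fin N → ℝ) => ∏ j, Real.exp (a i j * y j))]
  refine Finset.prod_congr rfl fun i _ => ?_
  rw [integral_fintype_prod_eq_prod (f := fun j (y : ℝ) => Real.exp (a i j * y))]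
  refine Finset.prod_congr rfl fun j _ => ?_
  have := congrFun (mgf_id_gaussianReal (μ := 0) (v := 1)) (a i j)
  simp only [mgf, id] at this
  simpa using this

instance (N : ℕ) (θ : Fin N → Fin N → ℝ) : IsProbabilityMeasure (PTheta N θ) := by
  unfold PTheta; infer_instance

lemma gaussian_Iic (N : ℕ) (hN : 0 < N) (m H : ℝ) :
    (gaussianReal m ((N : NNReal) ^ 2)).real (Set.Iic H) = stdGaussianCDF ((H - m) / N) := by
  have hN' : (0 : ℝ) < N := by exact_mod_cast hN
  have h1 : gaussianReal m ((N : NNReal) ^ 2)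
      = (gaussianReal 0 1).map (fun x => (N : ℝ) * x + m) := by
    have : (fun x : ℝ => (N : ℝ) * x + m) = (fun x => x + m) ∘ (fun x => (N : ℝ) * x) := rfl
    rw [this, ← Measure.map_map (by fun_prop) (by fun_prop), gaussianReal_map_const_mul,
      gaussianReal_map_add_const]
    congr 1
    · simp
    · ext; simp
  rw [h1, map_measureReal_apply (by fun_prop) measurableSet_Iic]
  unfold stdGaussianCDF Measure.real
  congr 2
  ext x
  simp only [Set.mem_preimage, Set.mem_Iic]
  rw [le_div_iff₀ hN']
  constructor <;> intro h <;> linarith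

lemma tilted_sum_law (N : ℕ) (a : Fin N → Fin N → ℝ) :
    ((PTheta N 0).tilted (fun x => ∑ i, ∑ j, a i j * x i j)).map
      (fun x : Fin N → Fin N → ℝ => ∑ i, ∑ j, x i j)
      = gaussianReal (∑ i, ∑ j, a i j) ((N : NNReal) ^ 2) := by
  set ν := (PTheta N 0).tilted (fun x => ∑ i, ∑ j, a i j * x i j) with hν
  have : IsProbabilityMeasure ν := isProbabilityMeasure_tilted (integrable_exp_lin N a)
  set f : (Fin N → Fin N → ℝ) → ℝ := fun x => ∑ i, ∑ j, x i j with hf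
  have hmeas : Measurable f := by fun_prop
  have hmgf : mgf f ν = mgf id (gaussianReal (∑ i, ∑ j, a i j) ((N : NNReal) ^ 2)) := by
    rw [mgf_id_gaussianReal]
    ext t
    unfold mgf
    rw [hν, integral_exp_tilted, integral_exp_lin]
    have : ∀ x : Fin N → Fin N → ℝ, ((fun x : Fin N → Fin N → ℝ => ∑ i, ∑ j, a i j * x i j) + fun x => t * f x) x
        = ∑ i, ∑ j, (a i j + t) * x i j := by
      intro x
      simp only [Pi.add_apply, hf, Finset.mul_sum, ← Finset.sum_add_distrib, add_mul]
    simp_rw [this]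
    rw [integral_exp_lin, ← Real.exp_sub]
    congr 1
    simp only [← Finset.sum_sub_distrib]
    have : ∀ i j, (a i j + t) ^ 2 / 2 - a i j ^ 2 / 2 = a i j * t + t ^ 2 / 2 := by
      intro i j; ring
    simp only [this, Finset.sum_add_distrib, ← Finset.sum_mul]
    simp
    ring
  have hset : integrableExpSet f ν = Set.univ := by
    ext t
    simp only [Set.mem_univ, iff_true, integrableExpSet, Set.mem_ofPred_eq]
    rw [← mgf_pos_iff, hmgf, mgf_id_gaussianReal]
    exact Real.exp_pos _
  have key := Measure.ext_of_complexMGF_eq (μ := ν)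
    (μ' := gaussianReal (∑ i, ∑ j, a i j) ((N : NNReal) ^ 2)) (X := f) (Y := id)
    hmeas.aemeasurable aemeasurable_id (by
      ext z
      exact eqOn_complexMGF_of_mgf hmgf (by simp [hset]))
  simpa using key

lemma setIntegral_exp_lin (N : ℕ) (hN : 0 < N) (a : Fin N → Fin N → ℝ) (H : ℝ) :
    ∫ x in {x : Fin N → Fin N → ℝ | ∑ i, ∑ j, x i j ≤ H},
        Real.exp (∑ i, ∑ j, a i j * x i j) ∂(PTheta N 0)
      = Real.exp (∑ i, ∑ j, a i j ^ 2 / 2) * stdGaussianCDF ((H - ∑ i, ∑ j, a i j) / N) := by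
  rw [← gaussian_Iic N hN, ← tilted_sum_law, map_measureReal_apply (by fun_prop) measurableSet_Iic]
  unfold Measure.real
  have hs : (fun x : Fin N → Fin N → ℝ => ∑ i, ∑ j, x i j) ⁻¹' Set.Iic H
    = {x : Fin N → Fin N → ℝ | ∑ i, ∑ j, x i j ≤ H} := rfl
  rw [tilted_apply_eq_ofReal_integral, integral_exp_lin, hs, integral_div, ENNReal.toReal_ofReal]
  · field_simp
  · apply div_nonneg _ (Real.exp_pos _).le
    exact integral_nonneg fun x => (Real.exp_pos _).le

lemma pair_integral (n N : ℕ) (hN : 0 < N) (A H : ℝ) (S S' : SIdx n N) :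
    ∫ x in {x : Fin N → Fin N → ℝ | ∑ i, ∑ j, x i j ≤ H},
        (Real.exp (A * XS S x - A ^ 2 * (n : ℝ) ^ 2 / 2)
          * Real.exp (A * XS S' x - A ^ 2 * (n : ℝ) ^ 2 / 2)) ∂(PTheta N 0)
      = stdGaussianCDF ((H - 2 * A * (n : ℝ) ^ 2) / N) *
        Real.exp (A ^ 2 * ((S.1.1 ∩ S'.1.1).card : ℝ) * ((S.1.2 ∩ S'.1.2).card : ℝ)) ∧
    Integrable (fun x => Real.exp (A * XS S x - A ^ 2 * (n : ℝ) ^ 2 / 2)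
          * Real.exp (A * XS S' x - A ^ 2 * (n : ℝ) ^ 2 / 2)) (PTheta N 0) := by
  obtain ⟨⟨R, C⟩, hR, hC⟩ := S
  obtain ⟨⟨R', C'⟩, hR', hC'⟩ := S'
  simp only at hR hC hR' hC'
  simp only [XS]
  let u : Finset (Fin N) → Fin N → ℝ := fun s i => if i ∈ s then 1 else 0
  have hu : ∀ s, ∑ i, u s i = (s.card : ℝ) := by intro s; simp [u]
  have huu : ∀ s t i, u s i * u t i = u (s ∩ t) i := by
    intro s t i; simp only [u, Finset.mem_inter]; split_ifs <;> simp_all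
  let a : Fin N → Fin N → ℝ := fun i j => A * (u R i * u C j + u R' i * u C' j)
  have hX : ∀ (s t : Finset (Fin N)) (x : Fin N → Fin N → ℝ),
      ∑ i ∈ s, ∑ j ∈ t, x i j = ∑ i, ∑ j, u s i * u t j * x i j := by
    intro s t x
    simp only [u, mul_assoc, ← Finset.mul_sum]
    simp
  have hE : ∀ x : Fin N → Fin N → ℝ,
      Real.exp (A * (∑ i ∈ R, ∑ j ∈ C, x i j) - A ^ 2 * (n : ℝ) ^ 2 / 2)
        * Real.exp (A * (∑ i ∈ R', ∑ j ∈ C', x i j) - A ^ 2 * (n : ℝ) ^ 2 / 2)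
      = Real.exp (- (A ^ 2 * (n : ℝ) ^ 2)) * Real.exp (∑ i, ∑ j, a i j * x i j) := by
    intro x
    rw [← Real.exp_add, ← Real.exp_add, hX R C, hX R' C']
    congr 1
    have : ∑ i, ∑ j, a i j * x i j = A * (∑ i, ∑ j, u R i * u C j * x i j)
        + A * (∑ i, ∑ j, u R' i * u C' j * x i j) := by
      simp only [a, Finset.mul_sum, ← Finset.sum_add_distrib]
      refine Finset.sum_congr rfl fun i _ => Finset.sum_congr rfl fun j _ => ?_
      ring
    rw [this]; ring
  have h1 : ∑ i, ∑ j, a i j = 2 * A * (n : ℝ) ^ 2 := by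
    simp only [a, ← Finset.mul_sum, Finset.sum_add_distrib]
    simp only [← Finset.sum_mul, hu, hR, hC, hR', hC']
    ring
  have h2 : ∑ i, ∑ j, a i j ^ 2 / 2
      = A ^ 2 * (n : ℝ) ^ 2 + A ^ 2 * ((R ∩ R').card : ℝ) * ((C ∩ C').card : ℝ) := by
    have : ∀ i j, a i j ^ 2 / 2 = A ^ 2 / 2 * (u R i * u C j) + A ^ 2 / 2 * (u R' i * u C' j)
        + A ^ 2 * (u (R ∩ R') i * u (C ∩ C') j) := by
      intro i j
      have e1 := huu R R i
      have e2 := huu R' R' i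
      have e3 := huu C C j
      have e4 := huu C' C' j
      rw [Finset.inter_self] at e1 e2 e3 e4
      rw [← huu, ← huu]
      simp only [a]
      calc _ = A ^ 2 / 2 * ((u R i * u R i) * (u C j * u C j))
            + A ^ 2 / 2 * ((u R' i * u R' i) * (u C' j * u C' j))
            + A ^ 2 * (u R i * u R' i * (u C j * u C' j)) := by ring
        _ = _ := by rw [e1, e2, e3, e4]
    simp only [this, Finset.sum_add_distrib, ← Finset.mul_sum]
    simp only [← Finset.sum_mul, hu, hR, hC, hR', hC']
    ring
  simp_rw [hE]
  refine ⟨?_, (integrable_exp_lin N a).const_mul _⟩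
  rw [integral_const_mul, setIntegral_exp_lin N hN, h1, h2, ← mul_assoc, ← Real.exp_add, mul_comm]
  congr 2
  ring

lemma count_inter (n N : ℕ) (R : Finset (Fin N)) (hR : R.card = n) (h : ℕ → ℝ) :
    ∑ R' ∈ Finset.powersetCard n (Finset.univ : Finset (Fin N)), h (R ∩ R').card
      = ∑ k ∈ Finset.range (n + 1), ((n.choose k * (N - n).choose (n - k) : ℕ) : ℝ) * h k := by
  have hmap : ∀ R' ∈ Finset.powersetCard n (Finset.univ : Finset (Fin N)),
      (R ∩ R').card ∈ Finset.range (n + 1) := by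
    intro R' _
    rw [Finset.mem_range, Nat.lt_succ_iff, ← hR]
    exact Finset.card_le_card Finset.inter_subset_left
  rw [← Finset.sum_fiberwise_of_maps_to hmap]
  refine Finset.sum_congr rfl fun k hk => ?_
  have hk' : k ≤ n := Nat.lt_succ_iff.1 (Finset.mem_range.1 hk)
  rw [Finset.sum_congr rfl (g := fun _ => h k)
    (fun R' hR' => by rw [(Finset.mem_filter.1 hR').2]), Finset.sum_const, nsmul_eq_mul]
  congr 2
  have hc : Rᶜ.card = N - n := by rw [Finset.card_compl, hR, Fintype.card_fin]
  rw [← hc]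
  conv_rhs => rw [← hR]
  rw [hR, ← Finset.card_powersetCard (n - k) Rᶜ, ← hR, ← Finset.card_powersetCard k R, hR,
    ← Finset.card_product]
  refine Finset.card_bij' (fun R' _ => (R ∩ R', Rᶜ ∩ R')) (fun p _ => p.1 ∪ p.2) ?_ ?_ ?_ ?_
  · intro R' h'
    simp only [Finset.mem_filter, Finset.mem_powersetCard, Finset.subset_univ, true_and] at h'
    simp only [Finset.mem_product, Finset.mem_powersetCard, Finset.inter_subset_left, true_and]
    refine ⟨h'.2, ?_⟩
    have e : Rᶜ ∩ R' = R' \ R := by ext; simp [and_comm]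
    rw [e, Finset.card_sdiff, h'.1, h'.2]
  · rintro ⟨p, q⟩ hp
    simp only [Finset.mem_product, Finset.mem_powersetCard] at hp
    obtain ⟨⟨hp1, hp2⟩, hq1, hq2⟩ := hp
    have hd : Disjoint p q := Finset.disjoint_of_subset_left hp1
      (Finset.disjoint_of_subset_right hq1 disjoint_compl_right)
    simp only [Finset.mem_filter, Finset.mem_powersetCard, Finset.subset_univ, true_and]
    refine ⟨by rw [Finset.card_union_of_disjoint hd]; omega, ?_⟩
    have e : R ∩ (p ∪ q) = p := by
      ext x
      have h1 := @hp1 x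
      have h2 := @hq1 x
      simp only [Finset.mem_inter, Finset.mem_union, Finset.mem_compl] at *
      tauto
    rw [e, hp2]
  · intro R' _
    ext x; simp only [Finset.mem_inter, Finset.mem_union, Finset.mem_compl]; tauto
  · rintro ⟨p, q⟩ hp
    simp only [Finset.mem_product, Finset.mem_powersetCard] at hp
    obtain ⟨⟨hp1, hp2⟩, hq1, hq2⟩ := hp
    ext x
    · have h1 := @hp1 x
      have h2 := @hq1 x
      simp only [Finset.mem_inter, Finset.mem_union, Finset.mem_compl] at *
      tauto
    · have h1 := @hp1 x
      have h2 := @hq1 x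
      simp only [Finset.mem_inter, Finset.mem_union, Finset.mem_compl] at *
      tauto

lemma sum_SIdx (n N : ℕ) (F : Finset (Fin N) → Finset (Fin N) → ℝ) :
    ∑ S : SIdx n N, F S.1.1 S.1.2
      = ∑ R ∈ Finset.powersetCard n (Finset.univ : Finset (Fin N)),
          ∑ C ∈ Finset.powersetCard n (Finset.univ : Finset (Fin N)), F R C := by
  rw [← Finset.sum_product' (f := F)]
  symm
  exact Finset.sum_subtype (p := fun p : Finset (Fin N) × Finset (Fin N) =>
    p.1.card = n ∧ p.2.card = n) _ (by intro p; simp [Finset.mem_powersetCard])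
    (fun p => F p.1 p.2)

/-- **Truncated second moment identity.**  For positive integers n ≤ N, A, H ∈ ℝ and the
sum test `T = 1{X_{[N]×[N]} > H}`,
`E₀(L_π² 1{T = 0}) = Φ((H − 2An²)/N) Σ_{0 ≤ k,ℓ ≤ n} (N_{k,ℓ}/|S|) exp(A²kℓ)`,
where `N_{k,ℓ} = C(n,k) C(N−n,n−k) C(n,ℓ) C(N−n,n−ℓ)` and `|S| = C(N,n)²`. -/
theorem truncated_second_moment_identity (n N : ℕ) (hn : 0 < n) (hnN : n ≤ N) (A H : ℝ) :
    ∫ x in {x : Fin N → Fin N → ℝ | ∑ i, ∑ j, x i j ≤ H}, (Lpi n N A x) ^ 2 ∂(PTheta N 0)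
      = stdGaussianCDF ((H - 2 * A * (n : ℝ) ^ 2) / N) *
          ∑ k ∈ Finset.range (n + 1), ∑ l ∈ Finset.range (n + 1),
            ((n.choose k * (N - n).choose (n - k) * n.choose l * (N - n).choose (n - l) : ℕ) : ℝ)
              / (N.choose n : ℝ) ^ 2 * Real.exp (A ^ 2 * k * l) := by
  have hN : 0 < N := lt_of_lt_of_le hn hnN
  have hc0 : (N.choose n : ℝ) ≠ 0 := by exact_mod_cast (Nat.choose_pos hnN).ne'
  have hL : ∀ x, (Lpi n N A x) ^ 2 = (((N.choose n : ℝ) ^ 2)⁻¹) ^ 2 *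
      ∑ S : SIdx n N, ∑ S' : SIdx n N,
        (Real.exp (A * XS S x - A ^ 2 * (n : ℝ) ^ 2 / 2)
          * Real.exp (A * XS S' x - A ^ 2 * (n : ℝ) ^ 2 / 2)) := by
    intro x
    rw [Lpi, mul_pow, sq (∑ S : SIdx n N, _), Finset.sum_mul_sum]
  simp_rw [hL]
  rw [integral_const_mul, integral_finsetSum _ (fun S _ =>
    (integrable_finsetSum _ fun S' _ => (pair_integral n N hN A H S S').2.integrableOn))]
  have hI : ∀ S : SIdx n N,
      ∫ x in {x : Fin N → Fin N → ℝ | ∑ i, ∑ j, x i j ≤ H}, (∑ S' : SIdx n N,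
        (Real.exp (A * XS S x - A ^ 2 * (n : ℝ) ^ 2 / 2)
          * Real.exp (A * XS S' x - A ^ 2 * (n : ℝ) ^ 2 / 2))) ∂(PTheta N 0)
      = stdGaussianCDF ((H - 2 * A * (n : ℝ) ^ 2) / N) *
        ∑ k ∈ Finset.range (n + 1), ((n.choose k * (N - n).choose (n - k) : ℕ) : ℝ) *
          ∑ l ∈ Finset.range (n + 1), ((n.choose l * (N - n).choose (n - l) : ℕ) : ℝ) *
            Real.exp (A ^ 2 * k * l) := by
    intro S
    rw [integral_finsetSum _ (fun S' _ => (pair_integral n N hN A H S S').2.integrableOn)]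
    simp_rw [fun S' => (pair_integral n N hN A H S S').1]
    rw [← Finset.mul_sum, sum_SIdx n N (fun R' C' =>
      Real.exp (A ^ 2 * ((S.1.1 ∩ R').card : ℝ) * ((S.1.2 ∩ C').card : ℝ)))]
    congr 1
    rw [← count_inter n N S.1.1 S.2.1 (fun k =>
      ∑ l ∈ Finset.range (n + 1), ((n.choose l * (N - n).choose (n - l) : ℕ) : ℝ) *
            Real.exp (A ^ 2 * k * l))]
    refine Finset.sum_congr rfl fun R' _ => ?_
    exact count_inter n N S.1.2 S.2.2 (fun l => Real.exp (A ^ 2 * ((S.1.1 ∩ R').card : ℝ) * l))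
  simp_rw [hI]
  have hcard : ∑ S : SIdx n N, (1 : ℝ) = (N.choose n : ℝ) ^ 2 := by
    rw [sum_SIdx n N (fun _ _ => 1)]
    simp [sq]
  rw [Finset.sum_const, nsmul_eq_mul]
  have hcard' : ((Finset.univ : Finset (SIdx n N)).card : ℝ) = (N.choose n : ℝ) ^ 2 := by
    rw [← hcard]; simp
  rw [hcard', ← mul_assoc]
  have : (((N.choose n : ℝ) ^ 2)⁻¹) ^ 2 * (N.choose n : ℝ) ^ 2 = ((N.choose n : ℝ) ^ 2)⁻¹ := by
    field_simp
  rw [this, mul_left_comm]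
  congr 1
  rw [Finset.mul_sum]
  refine Finset.sum_congr rfl fun k _ => ?_
  rw [Finset.mul_sum, Finset.mul_sum]
  refine Finset.sum_congr rfl fun l _ => ?_
  push_cast
  ring

end
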